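/- Let R be a commutative ring, let A be a finitely presented commutative R-algebra, and let u : M → N be an A-linear map between finitely presented A-modules such that N is flat as an R-module. Then the following are equivalent: (i) for every prime ideal p of R, the induced map M ⊗_R κ(p) → N ⊗_R κ(p) is injective, where κ(p) is the residue field of R at p; (ii) u is injective and its cokernel is flat as an R-module. Moreover, if these conditions hold, then for every commutative R-algebra R′ the induced map M ⊗_R R′ → N ⊗_R R′ is injective. -/

import Mathlib

open TensorProduct

namespace FibInj

section L1
variable {R : Type*} [CommRing R] [IsLocalRing R]

local notation "𝔪" => IsLocalRing.maximalIdeal R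

/-- An injection into a module killed by the maximal ideal splits. -/
lemma exists_split {V' V : Type*} [AddCommGroup V'] [Module R V'] [AddCommGroup V] [Module R V]
    (f : V' →ₗ[R] V) (hf : Function.Injective f)
    (hV : ∀ r ∈ 𝔪, ∀ v : V, r • v = 0) : ∃ g : V →ₗ[R] V', g ∘ₗ f = LinearMap.id := by
  have hV1 : Module.IsTorsionBySet R V (𝔪 : Set R) := fun v r => hV r.1 r.2 v
  have hV2 : Module.IsTorsionBySet R V' (𝔪 : Set R) := fun v r => by
    apply hf
    have := hV r.1 r.2 (f v)
    simpa using this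
  let _ := Ideal.Quotient.field 𝔪
  let _ := hV1.module
  let _ := hV2.module
  have : IsScalarTower R (R ⧸ 𝔪) V := hV1.isScalarTower
  have : IsScalarTower R (R ⧸ 𝔪) V' := hV2.isScalarTower
  let f' : V' →ₗ[R ⧸ 𝔪] V := f.extendScalarsOfSurjective Ideal.Quotient.mk_surjective
  obtain ⟨g, hg⟩ := LinearMap.exists_leftInverse_of_injective f' (LinearMap.ker_eq_bot.2 hf)
  refine ⟨g.restrictScalars R, ?_⟩
  ext v
  exact LinearMap.congr_fun hg v

lemma lTensor_inj_of_killed (N : Type*) [AddCommGroup N] [Module R N]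
    {V' V : Type*} [AddCommGroup V'] [Module R V'] [AddCommGroup V] [Module R V]
    (f : V' →ₗ[R] V) (hf : Function.Injective f)
    (hV : ∀ r ∈ 𝔪, ∀ v : V, r • v = 0) : Function.Injective (f.lTensor N) := by
  obtain ⟨g, hg⟩ := exists_split f hf hV
  apply Function.LeftInverse.injective (g := g.lTensor N)
  intro x
  rw [← LinearMap.comp_apply, ← LinearMap.lTensor_comp, hg, LinearMap.lTensor_id]
  rfl

lemma lTensor_exact_of_killed (N : Type*) [AddCommGroup N] [Module R N]
    {D K V : Type*} [AddCommGroup D] [Module R D] [AddCommGroup K] [Module R K]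
    [AddCommGroup V] [Module R V]
    (f : D →ₗ[R] K) (g : K →ₗ[R] V) (h : Function.Exact f g)
    (hV : ∀ r ∈ 𝔪, ∀ v : V, r • v = 0) : Function.Exact (f.lTensor N) (g.lTensor N) := by
  have h1 : Function.Exact f g.rangeRestrict := by
    intro y
    rw [← h y, ← Subtype.coe_inj]; rfl
  have h2 := lTensor_exact N h1 g.surjective_rangeRestrict
  have h3 := lTensor_inj_of_killed N (LinearMap.range g).subtype Subtype.val_injective hV
  intro y
  rw [← h2 y]
  have : g.lTensor N y = (LinearMap.range g).subtype.lTensor N (g.rangeRestrict.lTensor N y) := by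
    rw [← LinearMap.comp_apply, ← LinearMap.lTensor_comp]; rfl
  rw [this]
  exact ⟨fun h => h3 (by rw [h, map_zero]), fun h => by rw [h, map_zero]⟩

lemma lTensor_inj_aux (N : Type*) [AddCommGroup N] [Module R N]
    {L' L F G : Type*} [AddCommGroup L'] [Module R L'] [AddCommGroup L] [Module R L]
    [AddCommGroup F] [Module R F] [AddCommGroup G] [Module R G]
    (π : F →ₗ[R] L) (ι : G →ₗ[R] F) (ρ : G →ₗ[R] L') (s : L' →ₗ[R] L)
    (hs : Function.Injective s)
    (hπ : Function.Surjective π) (hρ : Function.Surjective ρ) (hcomm : s ∘ₗ ρ = π ∘ₗ ι)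
    (hF : ∀ r ∈ 𝔪, ∀ v : F, r • v ∈ LinearMap.range ι)
    (key : ∀ t : N ⊗[R] G, ι.lTensor N t = 0 → ρ.lTensor N t = 0) :
    Function.Injective (s.lTensor N) := by
  rw [injective_iff_map_eq_zero]
  intro z hz
  obtain ⟨z', rfl⟩ := LinearMap.lTensor_surjective N hρ z
  have hz1 : π.lTensor N (ι.lTensor N z') = 0 := by
    rw [← hz, ← LinearMap.comp_apply, ← LinearMap.comp_apply, ← LinearMap.lTensor_comp,
      ← LinearMap.lTensor_comp, hcomm]
  have hk : Function.Exact ((LinearMap.ker π).subtype) π := LinearMap.exact_subtype_ker_map π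
  obtain ⟨w, hw⟩ := (lTensor_exact N hk hπ _).1 hz1
  -- exactness of ker ρ → ker π → F / 𝔪 F
  let D := LinearMap.ker ρ
  let j : D →ₗ[R] LinearMap.ker π := LinearMap.codRestrict _ (ι ∘ₗ D.subtype) (by
    rintro ⟨d, hd⟩
    have := LinearMap.congr_fun hcomm d
    rw [LinearMap.mem_ker]
    simp only [LinearMap.comp_apply] at this ⊢
    rw [Submodule.subtype_apply, ← this, LinearMap.mem_ker.1 hd, map_zero])
  let q : LinearMap.ker π →ₗ[R] (F ⧸ LinearMap.range ι) :=
    (LinearMap.range ι).mkQ ∘ₗ (LinearMap.ker π).subtype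
  have hex : Function.Exact j q := by
    rintro ⟨y, hy⟩
    constructor
    · intro h
      obtain ⟨d, hd⟩ := (Submodule.Quotient.mk_eq_zero _).1 h
      refine ⟨⟨d, ?_⟩, Subtype.ext hd⟩
      have := LinearMap.congr_fun hcomm d
      simp only [LinearMap.comp_apply, Submodule.subtype_apply] at this hd
      rw [hd, LinearMap.mem_ker.1 hy] at this
      exact hs (by rw [this, map_zero])
    · rintro ⟨d, hd⟩
      refine (Submodule.Quotient.mk_eq_zero _).2 ⟨d.1, ?_⟩
      exact congrArg Subtype.val hd
  have hkill : ∀ r ∈ 𝔪, ∀ v : (F ⧸ LinearMap.range ι), r • v = 0 := by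
    intro r hr v
    obtain ⟨v, rfl⟩ := Submodule.Quotient.mk_surjective _ v
    rw [← Submodule.Quotient.mk_smul, Submodule.Quotient.mk_eq_zero]
    exact hF r hr v
  have hqw : q.lTensor N w = 0 := by
    have : q.lTensor N w = (LinearMap.range ι).mkQ.lTensor N (ι.lTensor N z') := by
      rw [← hw, ← LinearMap.comp_apply, ← LinearMap.lTensor_comp]
    rw [this, ← LinearMap.comp_apply, ← LinearMap.lTensor_comp, LinearMap.range_mkQ_comp]
    simp
  obtain ⟨d, hd⟩ := (lTensor_exact_of_killed N j q hex hkill w).1 hqw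
  have h0 : ρ.lTensor N (D.subtype.lTensor N d) = 0 := by
    rw [← LinearMap.comp_apply, ← LinearMap.lTensor_comp, LinearMap.comp_ker_subtype]; simp
  have h1 : ι.lTensor N (z' - D.subtype.lTensor N d) = 0 := by
    rw [map_sub, sub_eq_zero, ← hw, ← hd, ← LinearMap.comp_apply, ← LinearMap.comp_apply,
      ← LinearMap.lTensor_comp, ← LinearMap.lTensor_comp]
    rfl
  have := key _ h1
  rwa [map_sub, h0, sub_zero] at this

/-- multiplication by an element `l`, from the maximal ideal to `𝔪 L`. -/
def mulTo {L : Type*} [AddCommGroup L] [Module R L] (l : L) :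
    𝔪 →ₗ[R] ((𝔪 • ⊤ : Submodule R L)) :=
  LinearMap.codRestrict _ ((LinearMap.toSpanSingleton R L l) ∘ₗ (𝔪).subtype)
    (fun c => Submodule.smul_mem_smul c.2 trivial)

@[simp] lemma mulTo_coe {L : Type*} [AddCommGroup L] [Module R L] (l : L) (a : 𝔪) :
    ((mulTo l a : (𝔪 • ⊤ : Submodule R L)) : L) = (a : R) • l := rfl

lemma key_finsupp (N : Type*) [AddCommGroup N] [Module R N] {J L' : Type*}
    [AddCommGroup L'] [Module R L'] (μ : J → (𝔪 →ₗ[R] L'))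
    (hK : ∀ k : N ⊗[R] 𝔪, (𝔪).subtype.lTensor N k = 0 → ∀ l, (μ l).lTensor N k = 0)
    (t : N ⊗[R] (J →₀ 𝔪))
    (ht : (Finsupp.mapRange.linearMap (𝔪).subtype).lTensor N t = 0) :
    (Finsupp.lsum R μ).lTensor N t = 0 := by
  classical
  have e1 : ∀ t : N ⊗[R] (J →₀ 𝔪), ∀ l : J,
      (𝔪).subtype.lTensor N (TensorProduct.finsuppRight R R N 𝔪 J t l) =
        TensorProduct.finsuppRight R R N R J
          ((Finsupp.mapRange.linearMap (𝔪).subtype).lTensor N t) l := by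
    intro t l
    induction t with
    | zero => simp
    | add x y hx hy => simp [hx, hy]
    | tmul n f => simp [TensorProduct.finsuppRight_apply_tmul_apply]
  have e2 : (Finsupp.lsum R μ).lTensor N t =
      Finsupp.lsum R (fun l => (μ l).lTensor N) (TensorProduct.finsuppRight R R N 𝔪 J t) := by
    have : (Finsupp.lsum R μ).lTensor N = (Finsupp.lsum R (fun l => (μ l).lTensor N)) ∘ₗ
        (TensorProduct.finsuppRight R R N 𝔪 J).toLinearMap := by
      ext n l a : 4
      simp [TensorProduct.finsuppRight_tmul_single]
    exact LinearMap.congr_fun this t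
  rw [e2, Finsupp.lsum_apply, Finsupp.sum]
  refine Finset.sum_eq_zero fun l _ => hK _ ?_ l
  rw [e1, ht]; simp

lemma lTensor_max_smul_inj (N : Type*) [AddCommGroup N] [Module R N]
    {L : Type*} [AddCommGroup L] [Module R L]
    (hK : ∀ k : N ⊗[R] 𝔪, (𝔪).subtype.lTensor N k = 0 → ∀ l : L, (mulTo l).lTensor N k = 0) :
    Function.Injective ((𝔪 • ⊤ : Submodule R L).subtype.lTensor N) := by
  classical
  refine lTensor_inj_aux N (F := L →₀ R) (G := L →₀ 𝔪)
    (Finsupp.lsum R (fun l => LinearMap.toSpanSingleton R L l))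
    (Finsupp.mapRange.linearMap (𝔪).subtype) (Finsupp.lsum R (fun l => mulTo l))
    (𝔪 • ⊤ : Submodule R L).subtype Subtype.val_injective ?_ ?_ ?_ ?_ ?_
  · exact fun l => ⟨Finsupp.single l 1, by simp⟩
  · rintro ⟨y, hy⟩
    have : y ∈ LinearMap.range ((𝔪 • ⊤ : Submodule R L).subtype ∘ₗ
        (Finsupp.lsum R (fun l : L => mulTo (R := R) l))) := by
      refine Submodule.smul_induction_on hy ?_ ?_
      · intro r hr n _
        exact ⟨Finsupp.single n ⟨r, hr⟩, by simp⟩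
      · intro x y hx hy; exact add_mem hx hy
    obtain ⟨w, hw⟩ := this
    exact ⟨w, Subtype.ext hw⟩
  · ext l a
    simp
  · intro r hr v
    induction v using Finsupp.induction_linear with
    | zero => simp
    | add f g hf hg => rw [smul_add]; exact add_mem hf hg
    | single a b =>
      refine ⟨Finsupp.single a ⟨r * b, Ideal.mul_mem_right _ _ hr⟩, ?_⟩
      simp
  · exact key_finsupp N _ hK

end L1
end FibInj

namespace FibInj

section L2
variable {R : Type*} [CommRing R] [IsLocalRing R]

local notation "𝔪" => IsLocalRing.maximalIdeal R

lemma rTensor_inj_of_killed {M N : Type*} [AddCommGroup M] [Module R M] [AddCommGroup N]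
    [Module R N] (u : M →ₗ[R] N) (hu : Function.Injective (u.rTensor (R ⧸ 𝔪)))
    {V : Type*} [AddCommGroup V] [Module R V]
    (hV : ∀ r ∈ 𝔪, ∀ v : V, r • v = 0) : Function.Injective (u.rTensor V) := by
  classical
  have hV1 : Module.IsTorsionBySet R V (𝔪 : Set R) := fun v r => hV r.1 r.2 v
  obtain ⟨J, ⟨e⟩⟩ : ∃ J : Set V, Nonempty (V ≃ₗ[R] (J →₀ (R ⧸ 𝔪))) := by
    let _ := Ideal.Quotient.field 𝔪
    let _ := hV1.module
    have : IsScalarTower R (R ⧸ 𝔪) V := hV1.isScalarTower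
    exact ⟨_, ⟨(Module.Basis.ofVectorSpace (R ⧸ 𝔪) V).repr.restrictScalars R⟩⟩
  rw [injective_iff_map_eq_zero]
  intro z hz
  have e1 : ∀ t : M ⊗[R] (J →₀ (R ⧸ 𝔪)), ∀ l : J,
      u.rTensor (R ⧸ 𝔪) (TensorProduct.finsuppRight R R M (R ⧸ 𝔪) J t l) =
        TensorProduct.finsuppRight R R N (R ⧸ 𝔪) J (u.rTensor _ t) l := by
    intro t l
    induction t with
    | zero => simp
    | add x y hx hy => simp [hx, hy]
    | tmul n f => simp [TensorProduct.finsuppRight_apply_tmul_apply]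
  have h2 : u.rTensor _ (e.toLinearMap.lTensor M z) = 0 := by
    rw [← LinearMap.comp_apply, LinearMap.rTensor_comp_lTensor, ← LinearMap.lTensor_comp_rTensor,
      LinearMap.comp_apply, hz, map_zero]
  have h3 : e.toLinearMap.lTensor M z = 0 := by
    apply (TensorProduct.finsuppRight R R M (R ⧸ 𝔪) J).injective
    ext l
    apply hu
    rw [e1, h2]; simp
  exact (e.lTensor M).injective (by rw [map_zero]; exact h3)

variable {S : Type*} [CommRing S] [Algebra R S]

variable (R S) in
/-- The map from the maximal ideal to its extension. -/
def toMap : 𝔪 →ₗ[R] ((𝔪).map (algebraMap R S)) :=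
  LinearMap.codRestrict (((𝔪).map (algebraMap R S)).restrictScalars R)
    (Algebra.linearMap R S ∘ₗ (𝔪).subtype) (fun c => Ideal.mem_map_of_mem _ c.2)

@[simp] lemma toMap_coe (a : 𝔪) : ((toMap R S a : (𝔪).map (algebraMap R S)) : S) =
  algebraMap R S a := rfl

variable (R S) in
/-- The kernel of `N ⊗ 𝔪 → N` dies in `N ⊗ 𝔪 S`. -/
def TorDies (N : Type*) [AddCommGroup N] [Module R N] : Prop :=
  ∀ k : N ⊗[R] 𝔪, (𝔪).subtype.lTensor N k = 0 → (toMap R S).lTensor N k = 0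

/-- multiplication by an element `l`, from `𝔪 S` to `𝔪 L`. -/
def mulTo' {L : Type*} [AddCommGroup L] [Module R L] [Module S L] [IsScalarTower R S L] (l : L) :
    ((𝔪).map (algebraMap R S)) →ₗ[R] ((𝔪 • ⊤ : Submodule R L)) :=
  LinearMap.codRestrict (𝔪 • ⊤ : Submodule R L)
    ((LinearMap.toSpanSingleton S L l).restrictScalars R ∘ₗ
      (((𝔪).map (algebraMap R S)).subtype.restrictScalars R))
    (fun c => by
      obtain ⟨c, hc⟩ := c
      change c • l ∈ _
      have hc' : c ∈ (𝔪 • ⊤ : Submodule R S) := by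
        rw [Ideal.smul_top_eq_map]; exact hc
      refine Submodule.smul_induction_on hc' ?_ ?_
      · intro r hr n _
        rw [smul_assoc]
        exact Submodule.smul_mem_smul hr trivial
      · intro x y hx hy; rw [add_smul]; exact add_mem hx hy)

lemma lTensor_inj_of_torDies {N : Type*} [AddCommGroup N] [Module R N] (hN : TorDies R S N)
    {L L' : Type*} [AddCommGroup L] [Module R L] [Module S L] [IsScalarTower R S L]
    [AddCommGroup L'] [Module R L'] (s : L' →ₗ[R] L) (hs : Function.Injective s)
    (hL : ∀ r ∈ 𝔪, ∀ l : L, r • l ∈ LinearMap.range s) : Function.Injective (s.lTensor N) := by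
  have h1 : Function.Injective ((𝔪 • ⊤ : Submodule R L).subtype.lTensor N) := by
    apply lTensor_max_smul_inj
    intro k hk l
    have : mulTo (R := R) l = mulTo' (S := S) l ∘ₗ toMap R S := by
      ext a
      change (a : R) • l = algebraMap R S a • l
      rw [algebraMap_smul]
    rw [this, LinearMap.lTensor_comp, LinearMap.comp_apply, hN k hk, map_zero]
  have hle : (𝔪 • ⊤ : Submodule R L) ≤ LinearMap.range s :=
    Submodule.smul_le.2 (fun r hr l _ => hL r hr l)
  let e := LinearEquiv.ofInjective s hs
  let i : (𝔪 • ⊤ : Submodule R L) →ₗ[R] L' := e.symm.toLinearMap ∘ₗ Submodule.inclusion hle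
  have hsi : ∀ x, s (i x) = x := by
    intro x
    change ((e (e.symm (Submodule.inclusion hle x)) : LinearMap.range s) : L) = x
    rw [e.apply_symm_apply]; rfl
  have hsi' : s ∘ₗ i = (𝔪 • ⊤ : Submodule R L).subtype := LinearMap.ext hsi
  have hex : Function.Exact i ((𝔪 • ⊤ : Submodule R L).mkQ ∘ₗ s) := by
    intro y
    constructor
    · intro h
      refine ⟨⟨s y, (Submodule.Quotient.mk_eq_zero _).1 h⟩, hs (hsi _)⟩
    · rintro ⟨y, rfl⟩
      refine (Submodule.Quotient.mk_eq_zero _).2 ?_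
      rw [hsi]; exact y.2
  have hkill : ∀ r ∈ 𝔪, ∀ v : (L ⧸ (𝔪 • ⊤ : Submodule R L)), r • v = 0 := by
    intro r hr v
    obtain ⟨v, rfl⟩ := Submodule.Quotient.mk_surjective _ v
    rw [← Submodule.Quotient.mk_smul, Submodule.Quotient.mk_eq_zero]
    exact Submodule.smul_mem_smul hr trivial
  rw [injective_iff_map_eq_zero]
  intro z hz
  obtain ⟨y, rfl⟩ := (lTensor_exact_of_killed N _ _ hex hkill z).1
    (by rw [LinearMap.lTensor_comp, LinearMap.comp_apply, hz, map_zero])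
  rw [← LinearMap.comp_apply, ← LinearMap.lTensor_comp, hsi'] at hz
  rw [h1 (hz.trans (map_zero _).symm), map_zero]

variable (R) in
/-- the inclusion of an ideal of `S` as an `R`-linear map. -/
abbrev inc (J : Ideal S) : J →ₗ[R] S := J.subtype.restrictScalars R

lemma pow_inj {N : Type*} [AddCommGroup N] [Module R N] (hN : TorDies R S N) (k : ℕ) :
    Function.Injective ((inc R (((𝔪).map (algebraMap R S)) ^ k)).lTensor N) := by
  induction k with
  | zero =>
    apply lTensor_inj_of_torDies hN _ Subtype.val_injective
    intro r hr l
    exact ⟨⟨r • l, by simp⟩, rfl⟩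
  | succ k ih =>
    have hle : ((𝔪).map (algebraMap R S)) ^ (k + 1) ≤ ((𝔪).map (algebraMap R S)) ^ k :=
      Ideal.pow_le_pow_right (Nat.le_succ k)
    let i : ↥(((𝔪).map (algebraMap R S)) ^ (k + 1)) →ₗ[R] ↥(((𝔪).map (algebraMap R S)) ^ k) :=
      (Submodule.inclusion hle).restrictScalars R
    have h : Function.Injective (i.lTensor N) := by
      apply lTensor_inj_of_torDies hN _ (Submodule.inclusion_injective hle)
      intro r hr l
      refine ⟨⟨r • (l : S), ?_⟩, rfl⟩
      rw [Algebra.smul_def, pow_succ']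
      exact Ideal.mul_mem_mul (Ideal.mem_map_of_mem _ hr) l.2
    have : inc R (((𝔪).map (algebraMap R S)) ^ (k + 1)) =
      inc R (((𝔪).map (algebraMap R S)) ^ k) ∘ₗ i := rfl
    rw [this, LinearMap.lTensor_comp]
    exact ih.comp h

lemma ker_mem_pow {M N : Type*} [AddCommGroup M] [Module R M] [AddCommGroup N]
    [Module R N] (u : M →ₗ[R] N) (hu : Function.Injective (u.rTensor (R ⧸ 𝔪)))
    (hN : TorDies R S N) (x : M ⊗[R] S) (hx : u.rTensor S x = 0) (k : ℕ) :
    x ∈ LinearMap.range ((inc R (((𝔪).map (algebraMap R S)) ^ k)).lTensor M) := by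
  induction k with
  | zero =>
    apply LinearMap.lTensor_surjective
    intro y
    exact ⟨⟨y, by simp⟩, rfl⟩
  | succ k ih =>
    obtain ⟨ξ, rfl⟩ := ih
    have hle : ((𝔪).map (algebraMap R S)) ^ (k + 1) ≤ ((𝔪).map (algebraMap R S)) ^ k :=
      Ideal.pow_le_pow_right (Nat.le_succ k)
    let i : ↥(((𝔪).map (algebraMap R S)) ^ (k + 1)) →ₗ[R] ↥(((𝔪).map (algebraMap R S)) ^ k) :=
      (Submodule.inclusion hle).restrictScalars R
    have h1 : u.rTensor _ ξ = 0 := by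
      apply pow_inj hN k
      rw [map_zero, ← hx, ← LinearMap.comp_apply, LinearMap.lTensor_comp_rTensor,
        ← LinearMap.rTensor_comp_lTensor, LinearMap.comp_apply]
    let q := (LinearMap.range i).mkQ
    have hkill : ∀ r ∈ 𝔪, ∀ v : (↥(((𝔪).map (algebraMap R S)) ^ k) ⧸ LinearMap.range i),
        r • v = 0 := by
      intro r hr v
      obtain ⟨v, rfl⟩ := Submodule.Quotient.mk_surjective _ v
      rw [← Submodule.Quotient.mk_smul, Submodule.Quotient.mk_eq_zero]
      refine ⟨⟨r • (v : S), ?_⟩, rfl⟩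
      rw [Algebra.smul_def, pow_succ']
      exact Ideal.mul_mem_mul (Ideal.mem_map_of_mem _ hr) v.2
    have h2 : q.lTensor M ξ = 0 := by
      apply rTensor_inj_of_killed u hu hkill
      rw [map_zero, ← LinearMap.comp_apply, LinearMap.rTensor_comp_lTensor,
        ← LinearMap.lTensor_comp_rTensor, LinearMap.comp_apply, h1, map_zero]
    obtain ⟨η, rfl⟩ := (lTensor_exact M (LinearMap.exact_map_mkQ_range i)
      (Submodule.mkQ_surjective _) ξ).1 h2
    refine ⟨η, ?_⟩
    rw [← LinearMap.comp_apply, ← LinearMap.lTensor_comp]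
    rfl

end L2
end FibInj

namespace FibInj

section L3
variable {R : Type*} [CommRing R] 

lemma exists_fg_kill {N P Q : Type*} [AddCommGroup N] [Module R N] [AddCommGroup P] [Module R P]
    [AddCommGroup Q] [Module R Q] [Module.Finite R P] (f : P →ₗ[R] Q) (k : N ⊗[R] P)
    (hk : f.lTensor N k = 0) :
    ∃ (Q' : Submodule R Q) (h : LinearMap.range f ≤ Q'), Q'.FG ∧
      (Submodule.inclusion h ∘ₗ f.rangeRestrict).lTensor N k = 0 := by
  have hfg : (LinearMap.range f).FG := Module.Finite.iff_fg.1 inferInstance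
  have h0 : LinearMap.rTensor N (LinearMap.range f).subtype
      (f.rangeRestrict.rTensor N (TensorProduct.comm R N P k)) = 0 := by
    rw [← LinearMap.comp_apply, ← LinearMap.rTensor_comp]
    change f.rTensor N (TensorProduct.comm R N P k) = 0
    rw [← LinearMap.comm_comp_lTensor_comp_comm_eq] 
    simp [hk]
  obtain ⟨Q', h, hQ', hz⟩ := TensorProduct.eq_zero_of_fg_of_subtype_eq_zero hfg h0
  refine ⟨Q', h, hQ', ?_⟩
  rw [← LinearMap.comp_apply, ← LinearMap.rTensor_comp, ← LinearMap.comm_comp_lTensor_comp_comm_eq] at hz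
  simpa using hz

variable [IsLocalRing R]

local notation "𝔪" => IsLocalRing.maximalIdeal R

/-- functoriality of the extended maximal ideal. -/
def mapMap {S T : Type*} [CommRing S] [Algebra R S] [CommRing T] [Algebra R T] (f : S →ₐ[R] T) :
    ((𝔪).map (algebraMap R S)) →ₗ[R] ((𝔪).map (algebraMap R T)) :=
  LinearMap.codRestrict (((𝔪).map (algebraMap R T)).restrictScalars R)
    (f.toLinearMap ∘ₗ (((𝔪).map (algebraMap R S)).subtype.restrictScalars R)) (fun c => by
      have := Ideal.mem_map_of_mem (f : S →+* T) c.2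
      rw [Ideal.map_map] at this
      have e : (f : S →+* T).comp (algebraMap R S) = algebraMap R T := f.comp_algebraMap
      rw [e] at this
      exact this)

@[simp] lemma mapMap_coe {S T : Type*} [CommRing S] [Algebra R S] [CommRing T] [Algebra R T]
    (f : S →ₐ[R] T) (a : (𝔪).map (algebraMap R S)) : (mapMap f a : T) = f a := rfl

lemma mapMap_comp {S T : Type*} [CommRing S] [Algebra R S] [CommRing T] [Algebra R T]
    (f : S →ₐ[R] T) : mapMap f ∘ₗ toMap R S = toMap R T := by
  ext a
  simp

lemma kill_mono {N S T : Type*} [AddCommGroup N] [Module R N]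
    [CommRing S] [Algebra R S] [CommRing T] [Algebra R T]
    (f : S →ₐ[R] T) (k : N ⊗[R] 𝔪) (hk : (toMap R S).lTensor N k = 0) :
    (toMap R T).lTensor N k = 0 := by
  rw [← mapMap_comp f, LinearMap.lTensor_comp, LinearMap.comp_apply, hk, map_zero]

lemma exists_subalg_mem {S : Type*} [CommRing S] [Algebra R S] (t : S)
    (ht : t ∈ (𝔪).map (algebraMap R S)) : ∃ S₁ : Subalgebra R S, S₁.FG ∧
      t ∈ LinearMap.range (S₁.val.toLinearMap ∘ₗ inc R ((𝔪).map (algebraMap R S₁))) := by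
  have ht' : t ∈ (𝔪 • ⊤ : Submodule R S) := by
    rw [Ideal.smul_top_eq_map]; exact ht
  refine Submodule.smul_induction_on ht' ?_ ?_
  · intro r hr n _
    refine ⟨Algebra.adjoin R {n}, by simpa using Subalgebra.fg_adjoin_finset (R := R) ({n} : Finset S), ?_⟩
    refine ⟨⟨algebraMap R _ r * ⟨n, Algebra.subset_adjoin rfl⟩,
      Ideal.mul_mem_right _ _ (Ideal.mem_map_of_mem _ hr)⟩, ?_⟩
    simp [Algebra.smul_def]
  · rintro x y ⟨S₁, h1, x, rfl⟩ ⟨S₂, h2, y, rfl⟩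
    refine ⟨S₁ ⊔ S₂, h1.sup h2, 
      mapMap (Subalgebra.inclusion le_sup_left) x + mapMap (Subalgebra.inclusion le_sup_right) y, ?_⟩
    simp

lemma mem_mono {S : Type*} [CommRing S] [Algebra R S] {t : S} {S₁ S₂ : Subalgebra R S}
    (h : S₁ ≤ S₂)
    (ht : t ∈ LinearMap.range (S₁.val.toLinearMap ∘ₗ inc R ((𝔪).map (algebraMap R S₁)))) :
    t ∈ LinearMap.range (S₂.val.toLinearMap ∘ₗ inc R ((𝔪).map (algebraMap R S₂))) := by
  obtain ⟨x, rfl⟩ := ht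
  exact ⟨mapMap (Subalgebra.inclusion h) x, rfl⟩

lemma exists_subalg_of_finset {S : Type*} [CommRing S] [Algebra R S]
    {ι : Type*} (P : ι → Subalgebra R S → Prop) (hP : ∀ i, ∀ S₁ S₂, S₁ ≤ S₂ → P i S₁ → P i S₂)
    (s : Finset ι) (h : ∀ i ∈ s, ∃ S₁ : Subalgebra R S, S₁.FG ∧ P i S₁) :
    ∃ S₁ : Subalgebra R S, S₁.FG ∧ ∀ i ∈ s, P i S₁ := by
  classical
  induction s using Finset.induction_on with
  | empty => exact ⟨⊥, Subalgebra.fg_bot, by simp⟩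
  | insert a s ha ih =>
    obtain ⟨S₁, h1, h1'⟩ := ih (fun i hi => h i (Finset.mem_insert_of_mem hi))
    obtain ⟨S₂, h2, h2'⟩ := h a (Finset.mem_insert_self _ _)
    refine ⟨S₁ ⊔ S₂, h1.sup h2, ?_⟩
    intro i hi
    rcases Finset.mem_insert.1 hi with rfl | hi
    · exact hP _ _ _ le_sup_right h2'
    · exact hP _ _ _ le_sup_left (h1' i hi)

lemma exists_subalg_kill [IsNoetherianRing R] {N S : Type*} [AddCommGroup N] [Module R N]
    [CommRing S] [Algebra R S] (k : N ⊗[R] 𝔪) (hk : (toMap R S).lTensor N k = 0) :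
    ∃ S₁ : Subalgebra R S, S₁.FG ∧ (toMap R S₁).lTensor N k = 0 := by
  obtain ⟨Q, h, ⟨s, hs⟩, hQ⟩ := exists_fg_kill (toMap R S) k hk
  obtain ⟨S₁, h1, h2⟩ := exists_subalg_of_finset (R := R)
    (fun (t : (𝔪).map (algebraMap R S)) S₁ => (t : S) ∈ LinearMap.range
      (S₁.val.toLinearMap ∘ₗ inc R ((𝔪).map (algebraMap R S₁))))
    (fun i S₁ S₂ h => mem_mono h) s (fun i _ => exists_subalg_mem i.1 i.2)
  refine ⟨S₁, h1, ?_⟩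
  have hinj : Function.Injective (S₁.val.toLinearMap ∘ₗ inc R ((𝔪).map (algebraMap R S₁))) :=
    Subtype.val_injective.comp Subtype.val_injective
  let e := LinearEquiv.ofInjective _ hinj
  have hle : Q ≤ Submodule.comap (inc R ((𝔪).map (algebraMap R S)))
      (LinearMap.range (S₁.val.toLinearMap ∘ₗ inc R ((𝔪).map (algebraMap R S₁)))) := by
    rw [← hs, Submodule.span_le]
    exact h2
  let g : Q →ₗ[R] ((𝔪).map (algebraMap R S₁)) := e.symm.toLinearMap ∘ₗ
    LinearMap.codRestrict _ (inc R ((𝔪).map (algebraMap R S)) ∘ₗ Q.subtype) (fun q => hle q.2)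
  have : toMap R S₁ = g ∘ₗ (Submodule.inclusion h ∘ₗ (toMap R S).rangeRestrict) := by
    apply LinearMap.ext
    intro a
    simp only [g, LinearMap.comp_apply]
    apply e.injective
    erw [e.apply_symm_apply]
    apply Subtype.ext
    rfl
  rw [this, LinearMap.lTensor_comp, LinearMap.comp_apply, hQ, map_zero]

lemma exists_subalg_torDies [IsNoetherianRing R] {A : Type*} [CommRing A] [Algebra R A]
    [IsNoetherianRing A] {N S : Type*} [AddCommGroup N] [Module R N] [Module A N]
    [IsScalarTower R A N] [Module.Finite A N] [CommRing S] [Algebra R S] (hN : TorDies R S N) :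
    ∃ S₁ : Subalgebra R S, S₁.FG ∧ TorDies R S₁ N := by
  have : Module.Finite A (N ⊗[R] 𝔪) :=
    Module.Finite.equiv (AlgebraTensorModule.cancelBaseChange R A A N 𝔪)
  let K := LinearMap.ker (AlgebraTensorModule.lTensor A N (𝔪).subtype)
  have hK : K.FG := IsNoetherian.noetherian _
  obtain ⟨s, hs⟩ := hK
  obtain ⟨S₁, h1, h2⟩ := exists_subalg_of_finset (R := R)
    (fun (k : N ⊗[R] 𝔪) (S₁ : Subalgebra R S) => (toMap R S₁).lTensor N k = 0)
    (fun i S₁ S₂ h => kill_mono (Subalgebra.inclusion h) i) s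
    (fun i hi => exists_subalg_kill i (hN i (by
      have : i ∈ K := by rw [← hs]; exact Submodule.subset_span hi
      exact this)))
  refine ⟨S₁, h1, ?_⟩
  have hle : K ≤ LinearMap.ker (AlgebraTensorModule.lTensor A N (toMap R S₁)) := by
    rw [← hs, Submodule.span_le]
    exact h2
  exact fun k hk => hle hk

end L3
end FibInj

namespace FibInj

section L4
variable {R : Type*} [CommRing R] [IsLocalRing R]

local notation "𝔪" => IsLocalRing.maximalIdeal R

/-- The map `A ⊗ 𝔪 S → M ⊗ S`, `a ⊗ s ↦ a x ⊗ s`. -/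
noncomputable def contr (A : Type*) [CommRing A] [Algebra R A] {M : Type*} [AddCommGroup M]
    [Module R M] [Module A M] [IsScalarTower R A M] (S : Type*) [CommRing S] [Algebra R S] (x : M) :
    A ⊗[R] ((𝔪).map (algebraMap R S)) →ₗ[R] M ⊗[R] S :=
  TensorProduct.map ((LinearMap.toSpanSingleton A M x).restrictScalars R)
    (inc R ((𝔪).map (algebraMap R S)))

lemma krull_step {A : Type*} [CommRing A] [Algebra R A]
    {M : Type*} [AddCommGroup M] [Module R M] [Module A M] [IsScalarTower R A M]
    [Module.Finite A M] {S : Type*} [CommRing S] [Algebra R S] [IsNoetherianRing (A ⊗[R] S)] (x : M)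
    (hx : ∀ k : ℕ, x ⊗ₜ[R] (1 : S) ∈
      LinearMap.range ((inc R (((𝔪).map (algebraMap R S)) ^ k)).lTensor M)) :
    ∃ y, contr A S x y = x ⊗ₜ[R] (1 : S) := by
  let B := A ⊗[R] S
  let J : Ideal B := Ideal.map (Algebra.TensorProduct.includeRight : S →ₐ[R] A ⊗[R] S)
    ((𝔪).map (algebraMap R S))
  let f : S →ₗ[R] M →ₗ[R] (B ⊗[A] M) :=
    LinearMap.mk₂ R (fun s m => ((1 : A) ⊗ₜ[R] s : B) ⊗ₜ[A] m)
      (by intros; simp [TensorProduct.tmul_add, TensorProduct.add_tmul])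
      (by intro c s m; rw [TensorProduct.tmul_smul]; rfl)
      (by intros; simp [TensorProduct.tmul_add, TensorProduct.add_tmul])
      (by intros; simp)
  let Φ : M ⊗[R] S →ₗ[R] (B ⊗[A] M) := TensorProduct.lift f.flip
  have hΦ : ∀ m s, Φ (m ⊗ₜ s) = ((1 : A) ⊗ₜ[R] s : B) ⊗ₜ[A] m := fun m s => rfl
  have h1 : ∀ k : ℕ, ∀ t : M ⊗[R] ↥(((𝔪).map (algebraMap R S)) ^ k),
      Φ ((inc R (((𝔪).map (algebraMap R S)) ^ k)).lTensor M t) ∈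
        (J ^ k • ⊤ : Submodule B (B ⊗[A] M)) := by
    intro k t
    induction t with
    | zero => simp
    | add a b ha hb => rw [map_add, map_add]; exact add_mem ha hb
    | tmul m s =>
      have : Φ ((inc R (((𝔪).map (algebraMap R S)) ^ k)).lTensor M (m ⊗ₜ s)) =
        ((1 : A) ⊗ₜ[R] (s : S) : B) • ((1 : B) ⊗ₜ[A] m) := by
        rw [LinearMap.lTensor_tmul, hΦ, TensorProduct.smul_tmul']
        simp
      rw [this]
      refine Submodule.smul_mem_smul ?_ trivial
      rw [← Ideal.map_pow]
      exact Ideal.mem_map_of_mem (Algebra.TensorProduct.includeRight : S →ₐ[R] A ⊗[R] S) s.2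
  have h2 : (1 : B) ⊗ₜ[A] x ∈ (⨅ i : ℕ, J ^ i • ⊤ : Submodule B (B ⊗[A] M)) := by
    rw [Submodule.mem_iInf]
    intro k
    obtain ⟨t, ht⟩ := hx k
    have := h1 k t
    rw [ht, hΦ] at this
    exact this
  obtain ⟨⟨b, hb⟩, hb2⟩ := (Ideal.mem_iInf_smul_pow_eq_bot_iff J _).1 h2
  obtain ⟨y, rfl⟩ := (Ideal.map_includeRight_eq (R := R) (A := A) ((𝔪).map (algebraMap R S))).le hb
  refine ⟨y, ?_⟩
  let Ψ : B ⊗[A] M → M ⊗[R] S := fun z =>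
    AlgebraTensorModule.cancelBaseChange R A A M S (TensorProduct.comm A B M z)
  have hΨ : ∀ b : B, Ψ (b ⊗ₜ x) = TensorProduct.map
      ((LinearMap.toSpanSingleton A M x).restrictScalars R) LinearMap.id b := by
    intro b
    simp only [Ψ, TensorProduct.comm_tmul]
    induction b using TensorProduct.induction_on with
    | zero => simp
    | add a b ha hb => rw [TensorProduct.tmul_add, map_add, ha, hb, map_add]
    | tmul a s =>
      refine (AlgebraTensorModule.cancelBaseChange_tmul R A A x s a).trans ?_
      simp
  have h3 := congrArg Ψ hb2
  rw [TensorProduct.smul_tmul', smul_eq_mul, mul_one, hΨ, hΨ] at h3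
  rw [Algebra.TensorProduct.one_def] at h3
  simp only [TensorProduct.map_tmul] at h3
  have h4 : (LinearMap.toSpanSingleton A M x).restrictScalars R (1 : A) = x := by simp
  rw [h4] at h3
  refine Eq.trans ?_ h3
  rw [← LinearMap.comp_apply]
  congr 1
  rw [LinearMap.lTensor, ← TensorProduct.map_comp]
  rfl

theorem core [IsNoetherianRing R] {A : Type*} [CommRing A] [Algebra R A] [Algebra.FiniteType R A]
    {M N : Type*} [AddCommGroup M] [Module R M] [Module A M] [IsScalarTower R A M]
    [AddCommGroup N] [Module R N] [Module A N] [IsScalarTower R A N]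
    [Module.Finite A M] [Module.Finite A N] (u : M →ₗ[A] N)
    {S : Type*} [CommRing S] [Algebra R S] (hN : TorDies R S N)
    (hu : Function.Injective ((u.restrictScalars R).rTensor (R ⧸ 𝔪))) (x : M)
    (hx : u x ⊗ₜ[R] (1 : S) = 0) :
    ∃ y, contr A S x y = x ⊗ₜ[R] (1 : S) := by
  have : IsNoetherianRing A := Algebra.FiniteType.isNoetherianRing R A
  obtain ⟨S₁, h1, h2⟩ := exists_subalg_torDies (A := A) hN
  have hx' : LinearMap.rTensor N (⊥ : Subalgebra R S).val.toLinearMap ((1 : (⊥ : Subalgebra R S)) ⊗ₜ u x) =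
     LinearMap.rTensor N (⊥ : Subalgebra R S).val.toLinearMap 0 := by
    have := congrArg (TensorProduct.comm R N S) hx
    simpa using this
  obtain ⟨S₂, hle, h3, h4⟩ := TensorProduct.Algebra.eq_of_fg_of_subtype_eq Subalgebra.fg_bot hx'
  let T := S₁ ⊔ S₂
  have hT : T.FG := h1.sup h3
  have hT1 : TorDies R T N := fun k hk =>
    kill_mono (Subalgebra.inclusion le_sup_left) k (h2 k hk)
  have hT2 : u x ⊗ₜ[R] (1 : T) = 0 := by
    have h5 : (1 : S₂) ⊗ₜ[R] u x = 0 := by simpa using h4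
    have := congrArg (fun z => TensorProduct.comm R T N
      ((Subalgebra.inclusion (le_sup_right : S₂ ≤ T)).toLinearMap.rTensor N z)) h5
    simpa using this
  have : Algebra.FiniteType R T := T.fg_iff_finiteType.1 hT
  have : Algebra.FiniteType A (A ⊗[R] T) := inferInstance
  have : IsNoetherianRing (A ⊗[R] T) := Algebra.FiniteType.isNoetherianRing A _
  obtain ⟨y, hy⟩ := krull_step (A := A) (S := T) x
    (fun k => ker_mem_pow (u.restrictScalars R) hu hT1 _ hT2 k)
  refine ⟨(mapMap T.val).lTensor A y, ?_⟩
  have := congrArg (T.val.toLinearMap.lTensor M) hy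
  rw [LinearMap.lTensor_tmul] at this
  refine Eq.trans ?_ (this.trans ?_)
  · rw [← LinearMap.comp_apply, ← LinearMap.comp_apply]
    congr 1
    rw [contr, contr, LinearMap.lTensor, LinearMap.lTensor, ← TensorProduct.map_comp,
      ← TensorProduct.map_comp]
    rfl
  · simp

end L4
end FibInj

namespace FibInj

section L5

lemma isBaseChange_pushout {R₀ R A₀ A : Type*} [CommRing R₀] [CommRing R] [CommRing A₀] [CommRing A]
    [Algebra R₀ R] [Algebra R₀ A₀] [Algebra R A] [Algebra A₀ A] [Algebra R₀ A]
    [IsScalarTower R₀ R A] [IsScalarTower R₀ A₀ A] [Algebra.IsPushout R₀ R A₀ A]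
    {M₀ M : Type*} [AddCommGroup M₀] [Module R₀ M₀] [Module A₀ M₀] [IsScalarTower R₀ A₀ M₀]
    [AddCommGroup M] [Module R₀ M] [Module A₀ M] [Module R M] [Module A M]
    [IsScalarTower R₀ R M] [IsScalarTower R₀ A₀ M] [IsScalarTower A₀ A M] [IsScalarTower R A M]
    (f : M₀ →ₗ[A₀] M) (hf : IsBaseChange A f) : IsBaseChange R (f.restrictScalars R₀) := by
  refine IsBaseChange.of_equiv
    ((Algebra.IsPushout.cancelBaseChange R₀ R A₀ A M₀).symm ≪≫ₗ hf.equiv.restrictScalars R) ?_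
  intro x
  simp [IsBaseChange.equiv_tmul]

/-- Base change in stages. -/
lemma exists_bc_equiv {R₀ R : Type*} [CommRing R₀] [CommRing R] [Algebra R₀ R]
    {M₀ M : Type*} [AddCommGroup M₀] [Module R₀ M₀] [AddCommGroup M] [Module R₀ M] [Module R M]
    [IsScalarTower R₀ R M] (f : M₀ →ₗ[R₀] M) (hf : IsBaseChange R f)
    (V : Type*) [AddCommGroup V] [Module R₀ V] [Module R V] [IsScalarTower R₀ R V] :
    ∃ e : M₀ ⊗[R₀] V ≃+ M ⊗[R] V, ∀ m v, e (m ⊗ₜ v) = f m ⊗ₜ v := by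
  refine ⟨(TensorProduct.comm R₀ M₀ V).toAddEquiv.trans
    ((AlgebraTensorModule.cancelBaseChange R₀ R R V M₀).symm.toAddEquiv.trans
      ((hf.equiv.lTensor V).toAddEquiv.trans (TensorProduct.comm R V M).toAddEquiv)), ?_⟩
  intro m v
  simp [IsBaseChange.equiv_tmul]

end L5
end FibInj

namespace FibInj

section L6

/-- comparison of fibers. -/
lemma fiber_inj_iff {R₀ R : Type*} [CommRing R₀] [CommRing R] [Algebra R₀ R]
    {M₀ M N₀ N : Type*} [AddCommGroup M₀] [Module R₀ M₀] [AddCommGroup M] [Module R₀ M] [Module R M]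
    [IsScalarTower R₀ R M] [AddCommGroup N₀] [Module R₀ N₀] [AddCommGroup N] [Module R₀ N]
    [Module R N] [IsScalarTower R₀ R N] (f : M₀ →ₗ[R₀] M) (hf : IsBaseChange R f)
    (g : N₀ →ₗ[R₀] N) (hg : IsBaseChange R g) (u₀ : M₀ →ₗ[R₀] N₀) (u : M →ₗ[R] N)
    (hu : ∀ m, u (f m) = g (u₀ m))
    (V : Type*) [AddCommGroup V] [Module R₀ V] [Module R V] [IsScalarTower R₀ R V] :
    Function.Injective (u₀.rTensor V) ↔ Function.Injective (u.rTensor V) := by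
  obtain ⟨e, he⟩ := exists_bc_equiv f hf V
  obtain ⟨e', he'⟩ := exists_bc_equiv g hg V
  have h : ∀ z, u.rTensor V (e z) = e' (u₀.rTensor V z) := by
    intro z
    induction z with
    | zero => simp
    | add a b ha hb => simp only [map_add, ha, hb]
    | tmul m v => simp [he, he', hu]
  have h1 : (u.rTensor V) ∘ e = e' ∘ (u₀.rTensor V) := funext h
  rw [← EquivLike.injective_comp e, h1, EquivLike.comp_injective]

lemma torDies_of_flat {R₀ R : Type*} [CommRing R₀] [IsLocalRing R₀] [CommRing R] [Algebra R₀ R]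
    {N₀ N : Type*} [AddCommGroup N₀] [Module R₀ N₀] [AddCommGroup N] [Module R₀ N]
    [Module R N] [IsScalarTower R₀ R N]
    (g : N₀ →ₗ[R₀] N) (hg : IsBaseChange R g) [Module.Flat R N] : TorDies R₀ R N₀ := by
  intro k hk
  obtain ⟨e, he⟩ := exists_bc_equiv g hg ((IsLocalRing.maximalIdeal R₀).map (algebraMap R₀ R))
  obtain ⟨e', he'⟩ := exists_bc_equiv g hg R
  have h : ∀ z, ((IsLocalRing.maximalIdeal R₀).map (algebraMap R₀ R)).subtype.lTensor N
      (e ((toMap R₀ R).lTensor N₀ z)) = e' ((Algebra.linearMap R₀ R).lTensor N₀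
        ((IsLocalRing.maximalIdeal R₀).subtype.lTensor N₀ z)) := by
    intro z
    induction z with
    | zero => simp
    | add a b ha hb => simp only [map_add, ha, hb]
    | tmul m v => simp [he, he']
  apply e.injective
  apply Module.Flat.lTensor_preserves_injective_linearMap (M := N)
    ((IsLocalRing.maximalIdeal R₀).map (algebraMap R₀ R)).subtype (Subtype.val_injective)
  rw [h, hk]
  simp

theorem transfer {R₀ R A₀ A : Type*} [CommRing R₀] [CommRing R] [CommRing A₀] [CommRing A]
    [Algebra R₀ R] [Algebra R₀ A₀] [Algebra R A] [Algebra A₀ A] [Algebra R₀ A]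
    [IsScalarTower R₀ R A] [IsScalarTower R₀ A₀ A] [Algebra.IsPushout R₀ R A₀ A]
    [IsLocalRing R₀] [IsNoetherianRing R₀] [IsLocalRing R] [IsLocalHom (algebraMap R₀ R)]
    [Algebra.FiniteType R₀ A₀]
    {M₀ M N₀ N : Type*} [AddCommGroup M₀] [Module R₀ M₀] [Module A₀ M₀] [IsScalarTower R₀ A₀ M₀]
    [AddCommGroup M] [Module R₀ M] [Module A₀ M] [Module R M] [Module A M]
    [IsScalarTower R₀ R M] [IsScalarTower R₀ A₀ M] [IsScalarTower A₀ A M] [IsScalarTower R A M]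
    [AddCommGroup N₀] [Module R₀ N₀] [Module A₀ N₀] [IsScalarTower R₀ A₀ N₀]
    [AddCommGroup N] [Module R₀ N] [Module A₀ N] [Module R N] [Module A N]
    [IsScalarTower R₀ R N] [IsScalarTower R₀ A₀ N] [IsScalarTower A₀ A N] [IsScalarTower R A N]
    [Module.Finite A₀ M₀] [Module.Finite A₀ N₀]
    (f : M₀ →ₗ[A₀] M) (hf : IsBaseChange A f) (g : N₀ →ₗ[A₀] N) (hg : IsBaseChange A g)
    (u₀ : M₀ →ₗ[A₀] N₀) (u : M →ₗ[A] N) (hu : ∀ m, u (f m) = g (u₀ m)) [Module.Flat R N]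
    (hinj : Function.Injective ((u.restrictScalars R).rTensor (R ⧸ IsLocalRing.maximalIdeal R)))
    (x : M₀) (hx : u (f x) = 0) :
    ∃ a ∈ (IsLocalRing.maximalIdeal R).map (algebraMap R A), a • f x = f x := by
  have hf' := isBaseChange_pushout (R₀ := R₀) (R := R) f hf
  have hg' := isBaseChange_pushout (R₀ := R₀) (R := R) g hg
  have h0 : Function.Injective ((u₀.restrictScalars R₀).rTensor
      (R₀ ⧸ IsLocalRing.maximalIdeal R₀)) := by
    have h1 : Function.Injective ((u₀.restrictScalars R₀).rTensor
      (R ⧸ IsLocalRing.maximalIdeal R)) :=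
      (fiber_inj_iff (f.restrictScalars R₀) hf' (g.restrictScalars R₀) hg'
      (u₀.restrictScalars R₀) (u.restrictScalars R) hu (R ⧸ IsLocalRing.maximalIdeal R)).2 hinj
    have hle : IsLocalRing.maximalIdeal R₀ ≤ (IsLocalRing.maximalIdeal R).comap (algebraMap R₀ R) :=
      (IsLocalRing.maximalIdeal_comap (algebraMap R₀ R)).ge
    let j : (R₀ ⧸ IsLocalRing.maximalIdeal R₀) →ₗ[R₀] (R ⧸ IsLocalRing.maximalIdeal R) :=
      (IsLocalRing.maximalIdeal R₀).mapQ ((IsLocalRing.maximalIdeal R).restrictScalars R₀)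
        (Algebra.linearMap R₀ R) hle
    have hj : Function.Injective j := by
      rw [← LinearMap.ker_eq_bot, LinearMap.ker_eq_bot']
      intro z hz
      obtain ⟨z, rfl⟩ := Submodule.Quotient.mk_surjective _ z
      have hz' : (Submodule.Quotient.mk (algebraMap R₀ R z) :
        R ⧸ IsLocalRing.maximalIdeal R) = 0 := hz
      rw [Submodule.Quotient.mk_eq_zero] at hz' ⊢
      exact (IsLocalRing.maximalIdeal_comap (algebraMap R₀ R)).le hz'
    have h2 := lTensor_inj_of_killed M₀ j hj (by
      intro r hr v
      obtain ⟨v, rfl⟩ := Submodule.Quotient.mk_surjective _ v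
      rw [← Submodule.Quotient.mk_smul, Submodule.Quotient.mk_eq_zero, Algebra.smul_def]
      exact Ideal.mul_mem_right _ _ (hle hr))
    have h3 := h1.comp h2
    rw [← LinearMap.coe_comp, LinearMap.rTensor_comp_lTensor, ← LinearMap.lTensor_comp_rTensor,
      LinearMap.coe_comp] at h3
    exact h3.of_comp
  have hT : TorDies R₀ R N₀ := torDies_of_flat (g.restrictScalars R₀) hg'
  have hx0 : u₀ x ⊗ₜ[R₀] (1 : R) = 0 := by
    obtain ⟨e', he'⟩ := exists_bc_equiv (g.restrictScalars R₀) hg' R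
    apply e'.injective
    rw [he', LinearMap.restrictScalars_apply, ← hu, hx]
    simp
  obtain ⟨y, hy⟩ := core (A := A₀) u₀ hT h0 x hx0
  obtain ⟨e, he⟩ := exists_bc_equiv (f.restrictScalars R₀) hf' R
  have key : ∀ y : A₀ ⊗[R₀] ((IsLocalRing.maximalIdeal R₀).map (algebraMap R₀ R)),
      ∃ a ∈ (IsLocalRing.maximalIdeal R).map (algebraMap R A),
      TensorProduct.rid R M (e (contr A₀ R x y)) = a • f x := by
    intro y
    induction y with
    | zero => exact ⟨0, zero_mem _, by simp⟩
    | add y z hy hz =>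
      obtain ⟨a, ha, h⟩ := hy
      obtain ⟨b, hb, h'⟩ := hz
      exact ⟨a + b, add_mem ha hb, by simp only [map_add, add_smul, h, h']⟩
    | tmul c s =>
      refine ⟨algebraMap R A s * algebraMap A₀ A c, Ideal.mul_mem_right _ _
        (Ideal.mem_map_of_mem _ ?_), ?_⟩
      · exact Ideal.map_le_iff_le_comap.2 (IsLocalRing.maximalIdeal_comap (algebraMap R₀ R)).ge s.2
      · have : contr A₀ R x (c ⊗ₜ s) = (c • x) ⊗ₜ (s : R) := rfl
        rw [this, he]
        simp [mul_smul]
  obtain ⟨a, ha, h⟩ := key y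
  refine ⟨a, ha, ?_⟩
  rw [← h, hy, he]
  simp

end L6
end FibInj

namespace FibInj

section L7

lemma presBC {A₀ A : Type*} [CommRing A₀] [CommRing A] [Algebra A₀ A] {ι : Type*} [Fintype ι]
    [DecidableEq ι] (G₀ : Set (ι → A₀)) {N : Type*} [AddCommGroup N] [Module A₀ N] [Module A N]
    [IsScalarTower A₀ A N] (π : (ι → A) →ₗ[A] N) (hπ : Function.Surjective π)
    (hk : LinearMap.ker π = Submodule.span A ((Algebra.linearMap A₀ A).compLeft ι '' G₀)) :
    ∃ g : ((ι → A₀) ⧸ Submodule.span A₀ G₀) →ₗ[A₀] N, IsBaseChange A g ∧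
      ∀ v, g (Submodule.Quotient.mk v) = π ((Algebra.linearMap A₀ A).compLeft ι v) := by
  let g : ((ι → A₀) ⧸ Submodule.span A₀ G₀) →ₗ[A₀] N :=
    (Submodule.span A₀ G₀).liftQ (π.restrictScalars A₀ ∘ₗ (Algebra.linearMap A₀ A).compLeft ι) (by
      rw [Submodule.span_le]
      intro w hw
      have : (Algebra.linearMap A₀ A).compLeft ι w ∈ LinearMap.ker π := by
        rw [hk]; exact Submodule.subset_span ⟨w, hw, rfl⟩
      exact this)
  have hg : ∀ v, g (Submodule.Quotient.mk v) = π ((Algebra.linearMap A₀ A).compLeft ι v) :=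
    fun v => rfl
  refine ⟨g, ?_, hg⟩
  apply IsBaseChange.of_lift_unique
  intro Q _ _ _ _ r
  let _ : AddCommGroup Q := Module.addCommMonoidToAddCommGroup A
  let T : (ι → A) →ₗ[A] Q := Fintype.linearCombination A
    (fun i => r (Submodule.Quotient.mk (Pi.single i 1)))
  have hT : ∀ v, T ((Algebra.linearMap A₀ A).compLeft ι v) = r (Submodule.Quotient.mk v) := by
    intro v
    have hv : v = ∑ i, v i • (Pi.single i (1 : A₀) : ι → A₀) := by
      ext j
      simp [Finset.sum_apply, Pi.single_apply]
    have h2 : r (Submodule.Quotient.mk v) =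
        ∑ i, v i • r (Submodule.Quotient.mk (Pi.single i (1 : A₀))) := by
      conv_lhs => rw [hv]
      change r ((Submodule.span A₀ G₀).mkQ _) = _
      rw [map_sum, map_sum]
      simp
    rw [h2]
    simp [T, Fintype.linearCombination_apply]
  have hle : LinearMap.ker π ≤ LinearMap.ker T := by
    rw [hk, Submodule.span_le]
    rintro _ ⟨w, hw, rfl⟩
    change T _ = 0
    rw [hT, (Submodule.Quotient.mk_eq_zero _).2 (Submodule.subset_span hw), map_zero]
  let T' : N →ₗ[A] Q := (LinearMap.ker π).liftQ T hle ∘ₗ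
    (π.quotKerEquivOfSurjective hπ).symm.toLinearMap
  have hT' : ∀ v, T' (π v) = T v := by
    intro v
    have : (π.quotKerEquivOfSurjective hπ).symm (π v) = Submodule.Quotient.mk v := by
      rw [LinearEquiv.symm_apply_eq]; rfl
    simp only [T', LinearMap.comp_apply, LinearEquiv.coe_coe, this]
    rfl
  refine ⟨T', ?_, ?_⟩
  · ext v
    simp only [LinearMap.comp_apply, LinearMap.restrictScalars_apply]
    change T' (g (Submodule.Quotient.mk _)) = _
    rw [hg, hT', hT]
    rfl
  · intro T'' h
    ext z
    obtain ⟨v, rfl⟩ := hπ z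
    rw [← LinearMap.comp_apply, ← LinearMap.comp_apply]
    congr 1
    apply LinearMap.pi_ext'
    intro i
    ext
    have h1 : (Pi.single i (1 : A) : ι → A) =
      (Algebra.linearMap A₀ A).compLeft ι (Pi.single i (1 : A₀)) := by
      ext j
      by_cases hj : j = i
      · subst hj; simp
      · simp [hj]
    simp only [LinearMap.comp_apply, LinearMap.coe_single]
    rw [h1, hT', hT, ← hg]
    exact LinearMap.congr_fun h _

/-- Extension by zero. -/
def extZ (A : Type*) [CommRing A] (ι κ : Type*) : (ι → A) →ₗ[A] (ι ⊕ κ → A) where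
  toFun v := Sum.elim v 0
  map_add' v w := by ext (i | i) <;> simp
  map_smul' a v := by ext (i | i) <;> simp

theorem descend {R₀ R A₀ A : Type*} [CommRing R₀] [CommRing R] [CommRing A₀] [CommRing A]
    [Algebra R₀ R] [Algebra R₀ A₀] [Algebra R A] [Algebra A₀ A] [Algebra R₀ A]
    [IsScalarTower R₀ R A] [IsScalarTower R₀ A₀ A] [Algebra.IsPushout R₀ R A₀ A]
    [IsLocalRing R₀] [IsNoetherianRing R₀] [IsLocalRing R] [IsLocalHom (algebraMap R₀ R)]
    [Algebra.FiniteType R₀ A₀]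
    {M N : Type*} [AddCommGroup M] [Module R M] [Module A M] [IsScalarTower R A M]
    [AddCommGroup N] [Module R N] [Module A N] [IsScalarTower R A N]
    (u : M →ₗ[A] N) [Module.Flat R N]
    (hinj : Function.Injective ((u.restrictScalars R).rTensor (R ⧸ IsLocalRing.maximalIdeal R)))
    {ι κ : Type*} [Fintype ι] [DecidableEq ι] [Fintype κ] [DecidableEq κ]
    (π : (ι → A) →ₗ[A] M) (hπ : Function.Surjective π)
    (τ : (ι ⊕ κ → A) →ₗ[A] N) (hτ : Function.Surjective τ)
    (hτπ : ∀ v, τ (extZ A ι κ v) = u (π v))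
    (G : Set (ι → A)) (hG : LinearMap.ker π = Submodule.span A G)
    (H : Set (ι ⊕ κ → A)) (hH : LinearMap.ker τ = Submodule.span A H) (v : ι → A)
    (hG' : ∀ g ∈ G, ∀ i, g i ∈ Set.range (algebraMap A₀ A))
    (hH' : ∀ h ∈ H, ∀ i, h i ∈ Set.range (algebraMap A₀ A))
    (hv' : ∀ i, v i ∈ Set.range (algebraMap A₀ A)) (hv : u (π v) = 0) :
    ∃ a ∈ (IsLocalRing.maximalIdeal R).map (algebraMap R A), a • π v = π v := by
  let _ : Module A₀ M := Module.compHom M (algebraMap A₀ A)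
  let _ : Module R₀ M := Module.compHom M (algebraMap R₀ R)
  let _ : Module A₀ N := Module.compHom N (algebraMap A₀ A)
  let _ : Module R₀ N := Module.compHom N (algebraMap R₀ R)
  have : IsScalarTower R₀ R M := IsScalarTower.of_algebraMap_smul fun _ _ => rfl
  have : IsScalarTower R₀ R N := IsScalarTower.of_algebraMap_smul fun _ _ => rfl
  have : IsScalarTower A₀ A M := IsScalarTower.of_algebraMap_smul fun _ _ => rfl
  have : IsScalarTower A₀ A N := IsScalarTower.of_algebraMap_smul fun _ _ => rfl
  have : IsScalarTower R₀ A₀ M := IsScalarTower.of_algebraMap_smul fun r m => by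
    rw [← IsScalarTower.algebraMap_smul A (algebraMap R₀ A₀ r) m,
      ← IsScalarTower.algebraMap_apply, IsScalarTower.algebraMap_apply R₀ R A,
      IsScalarTower.algebraMap_smul, IsScalarTower.algebraMap_smul]
  have : IsScalarTower R₀ A₀ N := IsScalarTower.of_algebraMap_smul fun r m => by
    rw [← IsScalarTower.algebraMap_smul A (algebraMap R₀ A₀ r) m,
      ← IsScalarTower.algebraMap_apply, IsScalarTower.algebraMap_apply R₀ R A,
      IsScalarTower.algebraMap_smul, IsScalarTower.algebraMap_smul]
  have hl : ∀ {ι : Type _} (v : ι → A), (∀ i, v i ∈ Set.range (algebraMap A₀ A)) →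
      ∃ w, (Algebra.linearMap A₀ A).compLeft ι w = v := by
    intro ι v hv
    choose w hw using hv
    exact ⟨w, funext hw⟩
  have hl' : ∀ {ι : Type _} (v : ι → A), (∀ i, v i ∈ Set.range (algebraMap A₀ A)) →
      ∃ w, (Algebra.linearMap A₀ A).compLeft ι w = v := by
    intro ι v hv
    choose w hw using hv
    exact ⟨w, funext hw⟩
  have hext : ∀ w : ι → A₀, extZ A ι κ ((Algebra.linearMap A₀ A).compLeft ι w) =
      (Algebra.linearMap A₀ A).compLeft (ι ⊕ κ) (extZ A₀ ι κ w) := by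
    intro w
    ext (i | i)
    · rfl
    · simp [extZ]
  let G₀ : Set (ι → A₀) := (Algebra.linearMap A₀ A).compLeft ι ⁻¹' G
  let H₀ : Set (ι ⊕ κ → A₀) := (Algebra.linearMap A₀ A).compLeft (ι ⊕ κ) ⁻¹' H ∪ extZ A₀ ι κ '' G₀
  have hG₀ : (Algebra.linearMap A₀ A).compLeft ι '' G₀ = G :=
    Set.image_preimage_eq_of_subset fun g hg => hl g (hG' g hg)
  have hH₀ : LinearMap.ker τ =
      Submodule.span A ((Algebra.linearMap A₀ A).compLeft (ι ⊕ κ) '' H₀) := by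
    rw [Set.image_union, Set.image_preimage_eq_of_subset fun h hh => hl' h (hH' h hh),
      Submodule.span_union, ← hH, eq_comm, sup_eq_left, Submodule.span_le]
    rintro _ ⟨_, ⟨w, hw, rfl⟩, rfl⟩
    rw [← hext]
    change τ _ = 0
    rw [hτπ]
    have : (Algebra.linearMap A₀ A).compLeft ι w ∈ LinearMap.ker π := by
      rw [hG]; exact Submodule.subset_span hw
    rw [LinearMap.mem_ker.1 this, map_zero]
  obtain ⟨f, hf, hf'⟩ := presBC (A₀ := A₀) G₀ π hπ (by rw [hG₀, hG])
  obtain ⟨g, hg, hg'⟩ := presBC (A₀ := A₀) H₀ τ hτ hH₀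
  let u₀ : ((ι → A₀) ⧸ Submodule.span A₀ G₀) →ₗ[A₀] ((ι ⊕ κ → A₀) ⧸ Submodule.span A₀ H₀) :=
    Submodule.mapQ _ _ (extZ A₀ ι κ) (by
      rw [Submodule.span_le]
      intro w hw
      exact Submodule.subset_span (Or.inr ⟨w, hw, rfl⟩))
  obtain ⟨w, rfl⟩ := hl v hv'
  have := transfer (R₀ := R₀) (R := R) f hf g hg u₀ u (by
    intro m
    obtain ⟨m, rfl⟩ := Submodule.Quotient.mk_surjective _ m
    rw [hf', ← hτπ, hext, ← hg']
    rfl) hinj (Submodule.Quotient.mk w) (by rw [hf', hv])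
  rw [hf'] at this
  exact this

end L7
end FibInj

namespace FibInj

section L8
universe v

lemma exists_noeth {R : Type v} [CommRing R] [IsLocalRing R] (t : Set R) (ht : t.Finite) :
    ∃ (R₀ : Type v) (_ : CommRing R₀) (_ : IsLocalRing R₀) (_ : IsNoetherianRing R₀)
      (_ : Algebra R₀ R), IsLocalHom (algebraMap R₀ R) ∧ t ⊆ Set.range (algebraMap R₀ R) := by
  let S := Algebra.adjoin ℤ t
  have hS : S.FG := Subalgebra.fg_def.2 ⟨t, ht, rfl⟩
  have : Algebra.FiniteType ℤ S := S.fg_iff_finiteType.1 hS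
  have : IsNoetherianRing S := Algebra.FiniteType.isNoetherianRing ℤ S
  let P : Ideal S := (IsLocalRing.maximalIdeal R).comap (algebraMap S R)
  have : P.IsPrime := Ideal.comap_isPrime _ _
  have hu : ∀ y : P.primeCompl, IsUnit (algebraMap S R y) := by
    intro y
    by_contra h
    exact y.2 ((IsLocalRing.mem_maximalIdeal _).2 h)
  let φ : Localization.AtPrime P →+* R := IsLocalization.lift (M := P.primeCompl) hu
  let _ : Algebra (Localization.AtPrime P) R := φ.toAlgebra
  have : IsNoetherianRing (Localization.AtPrime P) :=
    IsLocalization.isNoetherianRing P.primeCompl _ inferInstance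
  refine ⟨Localization.AtPrime P, inferInstance, inferInstance, inferInstance, inferInstance,
    ?_, ?_⟩
  · constructor
    intro a ha
    change IsUnit (φ a) at ha
    obtain ⟨r, s, rfl⟩ := IsLocalization.exists_mk'_eq P.primeCompl a
    have h1 : φ (IsLocalization.mk' (Localization.AtPrime P) r s) * algebraMap S R s =
        algebraMap S R r := by
      have : algebraMap S R s = φ (algebraMap S _ s) := (IsLocalization.lift_eq hu _).symm
      rw [this, ← map_mul, IsLocalization.mk'_spec]
      exact IsLocalization.lift_eq hu _
    have h2 : IsUnit (algebraMap S R r) := by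
      rw [← h1]; exact ha.mul (hu s)
    have h3 : r ∈ P.primeCompl := by
      intro h
      exact (IsLocalRing.mem_maximalIdeal _).1 h h2
    exact (IsLocalization.AtPrime.isUnit_mk'_iff _ P r s).2 h3
  · intro x hx
    refine ⟨algebraMap S _ ⟨x, Algebra.subset_adjoin hx⟩, ?_⟩
    exact IsLocalization.lift_eq hu _

attribute [local instance] MvPolynomial.algebraMvPolynomial in
lemma T_poly {R : Type v} [CommRing R] [IsLocalRing R] {σ : Type*} [Finite σ]
    {M N : Type*} [AddCommGroup M] [Module R M] [Module (MvPolynomial σ R) M]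
    [IsScalarTower R (MvPolynomial σ R) M]
    [AddCommGroup N] [Module R N] [Module (MvPolynomial σ R) N]
    [IsScalarTower R (MvPolynomial σ R) N]
    [Module.FinitePresentation (MvPolynomial σ R) M]
    [Module.FinitePresentation (MvPolynomial σ R) N]
    (u : M →ₗ[MvPolynomial σ R] N) [Module.Flat R N]
    (hinj : Function.Injective ((u.restrictScalars R).rTensor (R ⧸ IsLocalRing.maximalIdeal R)))
    (x : M) (hx : u x = 0) :
    ∃ a ∈ (IsLocalRing.maximalIdeal R).map (algebraMap R (MvPolynomial σ R)), a • x = x := by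
  classical
  let A := MvPolynomial σ R
  obtain ⟨b, c, π, -, hπ, -⟩ := Module.FinitePresentation.exists_fin' (MvPolynomial σ R) M
  obtain ⟨d, e, ρ, -, hρ, -⟩ := Module.FinitePresentation.exists_fin' (MvPolynomial σ R) N
  obtain ⟨G, hG⟩ := Module.FinitePresentation.fg_ker π hπ
  let τ : (Fin b ⊕ Fin d → A) →ₗ[A] N :=
    u ∘ₗ π ∘ₗ LinearMap.funLeft A A Sum.inl + ρ ∘ₗ LinearMap.funLeft A A Sum.inr
  have hτ : Function.Surjective τ := by
    intro n
    obtain ⟨w, rfl⟩ := hρ n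
    refine ⟨Sum.elim 0 w, ?_⟩
    change u (π 0) + ρ w = _
    simp
  obtain ⟨H, hH⟩ := Module.FinitePresentation.fg_ker τ hτ
  obtain ⟨v, rfl⟩ := hπ x
  let P : Set A := (⋃ g ∈ G, Set.range g) ∪ (⋃ h ∈ H, Set.range h) ∪ Set.range v
  have hP : P.Finite := by
    refine ((Set.Finite.biUnion G.finite_toSet ?_).union
      (Set.Finite.biUnion H.finite_toSet ?_)).union (Set.finite_range _) <;>
    exact fun _ _ => Set.finite_range _
  obtain ⟨R₀, _, _, _, _, hl, ht⟩ := exists_noeth (⋃ p ∈ P, (p.coeffs : Set R))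
    (Set.Finite.biUnion hP fun p _ => p.coeffs.finite_toSet)
  have hP' : ∀ p ∈ P, p ∈ Set.range (algebraMap (MvPolynomial σ R₀) (MvPolynomial σ R)) := by
    intro p hp
    have := (MvPolynomial.mem_range_map_iff_coeffs_subset (f := algebraMap R₀ R) (x := p)).2
      (fun r hr => ht (Set.mem_biUnion hp hr))
    exact this
  refine descend (R₀ := R₀) (A₀ := MvPolynomial σ R₀) u hinj π hπ τ hτ ?_ G hG.symm H hH.symm v
    ?_ ?_ ?_ hx
  · intro w
    change u (π w) + ρ 0 = _
    simp
  · exact fun g hg i => hP' _ (Or.inl (Or.inl (Set.mem_biUnion hg ⟨i, rfl⟩)))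
  · exact fun g hg i => hP' _ (Or.inl (Or.inr (Set.mem_biUnion hg ⟨i, rfl⟩)))
  · exact fun i => hP' _ (Or.inr ⟨i, rfl⟩)

lemma T_local {R : Type*} [CommRing R] [IsLocalRing R] {A : Type*} [CommRing A] [Algebra R A]
    (hA : Algebra.FinitePresentation R A)
    {M N : Type*} [AddCommGroup M] [Module R M] [Module A M] [IsScalarTower R A M]
    [AddCommGroup N] [Module R N] [Module A N] [IsScalarTower R A N]
    [Module.FinitePresentation A M] [Module.FinitePresentation A N]
    (u : M →ₗ[A] N) [Module.Flat R N]
    (hinj : Function.Injective ((u.restrictScalars R).rTensor (R ⧸ IsLocalRing.maximalIdeal R)))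
    (x : M) (hx : u x = 0) :
    ∃ a ∈ (IsLocalRing.maximalIdeal R).map (algebraMap R A), a • x = x := by
  obtain ⟨n, φ, hφ, hφ'⟩ := hA
  let _ : Algebra (MvPolynomial (Fin n) R) A := φ.toRingHom.toAlgebra
  have hAm : (algebraMap (MvPolynomial (Fin n) R) A) = φ.toRingHom := rfl
  have : IsScalarTower R (MvPolynomial (Fin n) R) A := IsScalarTower.of_algebraMap_eq'
    (by rw [hAm]; exact φ.comp_algebraMap.symm)
  let _ : Module (MvPolynomial (Fin n) R) M := Module.compHom M (algebraMap _ A)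
  let _ : Module (MvPolynomial (Fin n) R) N := Module.compHom N (algebraMap _ A)
  have : IsScalarTower (MvPolynomial (Fin n) R) A M := IsScalarTower.of_algebraMap_smul fun _ _ => rfl
  have : IsScalarTower (MvPolynomial (Fin n) R) A N := IsScalarTower.of_algebraMap_smul fun _ _ => rfl
  have : IsScalarTower R (MvPolynomial (Fin n) R) M := IsScalarTower.of_algebraMap_smul fun r m => by
    rw [← IsScalarTower.algebraMap_smul A (algebraMap R _ r) m,
      ← IsScalarTower.algebraMap_apply, IsScalarTower.algebraMap_smul]
  have : IsScalarTower R (MvPolynomial (Fin n) R) N := IsScalarTower.of_algebraMap_smul fun r m => by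
    rw [← IsScalarTower.algebraMap_smul A (algebraMap R _ r) m,
      ← IsScalarTower.algebraMap_apply, IsScalarTower.algebraMap_smul]
  have : Module.FinitePresentation (MvPolynomial (Fin n) R) A :=
    Module.finitePresentation_of_surjective (Algebra.linearMap (MvPolynomial (Fin n) R) A) hφ hφ'
  have : Module.FinitePresentation (MvPolynomial (Fin n) R) M :=
    Module.FinitePresentation.trans (MvPolynomial (Fin n) R) M A
  have : Module.FinitePresentation (MvPolynomial (Fin n) R) N :=
    Module.FinitePresentation.trans (MvPolynomial (Fin n) R) N A
  obtain ⟨a, ha, h⟩ := T_poly (u.restrictScalars (MvPolynomial (Fin n) R)) hinj x hx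
  refine ⟨algebraMap _ A a, ?_, ?_⟩
  · rw [IsScalarTower.algebraMap_eq R (MvPolynomial (Fin n) R) A, ← Ideal.map_map]
    exact Ideal.mem_map_of_mem _ ha
  · rw [IsScalarTower.algebraMap_smul, h]

end L8
end FibInj

namespace FibInj

section L9

lemma isBC {R R' A A' : Type*} [CommRing R] [CommRing R'] [CommRing A] [CommRing A']
    [Algebra R R'] [Algebra R A] [Algebra R' A'] [Algebra A A'] [Algebra R A']
    [IsScalarTower R R' A'] [IsScalarTower R A A'] [Algebra.IsPushout R R' A A']
    (M : Type*) [AddCommGroup M] [Module R M] [Module A M] [IsScalarTower R A M] :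
    IsBaseChange R' ((TensorProduct.mk A A' M 1).restrictScalars R) :=
  isBaseChange_pushout _ (TensorProduct.isBaseChange A M A')

lemma fiber_bc {R R' A A' : Type*} [CommRing R] [CommRing R'] [CommRing A] [CommRing A']
    [Algebra R R'] [Algebra R A] [Algebra R' A'] [Algebra A A'] [Algebra R A']
    [IsScalarTower R R' A'] [IsScalarTower R A A'] [Algebra.IsPushout R R' A A']
    {M N : Type*} [AddCommGroup M] [Module R M] [Module A M] [IsScalarTower R A M]
    [AddCommGroup N] [Module R N] [Module A N] [IsScalarTower R A N] (u : M →ₗ[A] N)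
    (V : Type*) [AddCommGroup V] [Module R V] [Module R' V] [IsScalarTower R R' V] :
    Function.Injective ((u.restrictScalars R).rTensor V) ↔
    Function.Injective (((u.baseChange A').restrictScalars R').rTensor V) :=
  fiber_inj_iff _ (isBC (R' := R') (A' := A') M) _ (isBC (R' := R') (A' := A') N)
    (u.restrictScalars R) ((u.baseChange A').restrictScalars R') (fun m => by simp) V

lemma flat_bc {R A : Type*} (R' A' : Type*) [CommRing R] [CommRing R'] [CommRing A] [CommRing A']
    [Algebra R R'] [Algebra R A] [Algebra R' A'] [Algebra A A'] [Algebra R A']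
    [IsScalarTower R R' A'] [IsScalarTower R A A'] [Algebra.IsPushout R R' A A']
    (N : Type*)
    [AddCommGroup N] [Module R N] [Module A N] [IsScalarTower R A N] [Module.Flat R N] :
    Module.Flat R' (A' ⊗[A] N) :=
  Module.Flat.isBaseChange R R' N (A' ⊗[A] N) (isBC (R' := R') (A' := A') N)

lemma field_ext {R : Type*} [CommRing R] {M N : Type*} [AddCommGroup M] [Module R M]
    [AddCommGroup N] [Module R N] (u : M →ₗ[R] N) (K L : Type*) [Field K] [Field L] [Algebra R K]
    [Algebra R L] [Algebra K L] [IsScalarTower R K L] (h : Function.Injective (u.rTensor K)) :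
    Function.Injective (u.rTensor L) := by
  rw [fiber_inj_iff _ (TensorProduct.isBaseChange R M K) _ (TensorProduct.isBaseChange R N K) u
    (u.baseChange K) (fun m => by simp) L]
  apply Module.Flat.rTensor_preserves_injective_linearMap
  exact (LinearMap.lTensor_inj_iff_rTensor_inj K u).2 h

lemma field_of_res {R : Type*} [CommRing R] {M N : Type*} [AddCommGroup M] [Module R M]
    [AddCommGroup N] [Module R N] (u : M →ₗ[R] N)
    (h : ∀ (p : Ideal R) (_ : p.IsPrime), Function.Injective (LinearMap.rTensor
          (IsLocalRing.ResidueField (Localization.AtPrime p)) u))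
    (L : Type*) [Field L] [Algebra R L] : Function.Injective (u.rTensor L) := by
  let p := RingHom.ker (algebraMap R L)
  have hp : p.IsPrime := RingHom.ker_isPrime _
  let φ : p.ResidueField →+* L := Ideal.ResidueField.lift p (algebraMap R L) le_rfl (by
    intro x hx
    exact IsUnit.mk0 _ hx)
  let _ : Algebra p.ResidueField L := φ.toAlgebra
  have : IsScalarTower R p.ResidueField L := IsScalarTower.of_algebraMap_eq fun r =>
    (Ideal.ResidueField.lift_algebraMap _ _ _ _ _).symm
  exact field_ext u p.ResidueField L (h p hp)

lemma localStep {R R' A A' : Type*} [CommRing R] [CommRing R'] [CommRing A] [CommRing A']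
    [Algebra R R'] [Algebra R A] [Algebra R' A'] [Algebra A A'] [Algebra R A']
    [IsScalarTower R R' A'] [IsScalarTower R A A'] [Algebra.IsPushout R R' A A']
    (hA' : Algebra.FinitePresentation R' A') [IsLocalRing R']
    {M N : Type*} [AddCommGroup M] [Module R M] [Module A M] [IsScalarTower R A M]
    [AddCommGroup N] [Module R N] [Module A N] [IsScalarTower R A N]
    [Module.FinitePresentation A M] [Module.FinitePresentation A N]
    (u : M →ₗ[A] N) [Module.Flat R N]
    (h : Function.Injective (LinearMap.rTensor
      (IsLocalRing.ResidueField R') (u.restrictScalars R))) (x : M) (hx : u x = 0) :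
    ∃ a ∈ (IsLocalRing.maximalIdeal R').map (algebraMap R' A'),
      a • ((1 : A') ⊗ₜ[A] x) = 1 ⊗ₜ x := by
  have hflat : Module.Flat R' (A' ⊗[A] N) := flat_bc (R := R) R' A' N
  have hinj : Function.Injective (((u.baseChange A').restrictScalars R').rTensor
      (R' ⧸ IsLocalRing.maximalIdeal R')) :=
    (fiber_bc (R := R) (R' := R') (A' := A') u (IsLocalRing.ResidueField R')).1 h
  exact T_local hA' (u.baseChange A') hinj (1 ⊗ₜ x) (by simp [hx])

attribute [local instance] Algebra.TensorProduct.rightAlgebra in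
theorem stepG {R : Type*} [CommRing R] {A : Type*} [CommRing A] [Algebra R A]
    (hA : Algebra.FinitePresentation R A)
    {M N : Type*} [AddCommGroup M] [Module R M] [Module A M] [IsScalarTower R A M]
    [AddCommGroup N] [Module R N] [Module A N] [IsScalarTower R A N]
    [Module.FinitePresentation A M] [Module.FinitePresentation A N]
    (u : M →ₗ[A] N) [Module.Flat R N]
    (h : ∀ (p : Ideal R) (_ : p.IsPrime), Function.Injective (LinearMap.rTensor
          (IsLocalRing.ResidueField (Localization.AtPrime p)) (u.restrictScalars R))) :
    Function.Injective u := by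
  rw [← LinearMap.ker_eq_bot, LinearMap.ker_eq_bot']
  intro x hx
  have hloc : ∀ (q : Ideal A) [q.IsMaximal],
      IsLocalizedModule q.primeCompl (TensorProduct.mk A (Localization.AtPrime q) M 1) := fun q _ =>
    (isLocalizedModule_iff_isBaseChange q.primeCompl (Localization.AtPrime q) _).2
      (TensorProduct.isBaseChange A M _)
  refine Module.eq_zero_of_localization_maximal
    (fun q _ => (Localization.AtPrime q) ⊗[A] M)
    (fun q _ => TensorProduct.mk A (Localization.AtPrime q) M 1) x ?_
  intro q hq
  let p := q.comap (algebraMap R A)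
  have hp : p.IsPrime := Ideal.comap_isPrime _ _
  let R' := Localization.AtPrime p
  let A' := R' ⊗[R] A
  have hA' : Algebra.FinitePresentation R' A' := inferInstance
  obtain ⟨a, ha, hax⟩ := localStep (R := R) (R' := R') (A := A) (A' := A') hA' u (h p hp) x hx
  let ψ := Localization.localRingHom p q (algebraMap R A) rfl
  let ψ' : R' →ₐ[R] Localization.AtPrime q :=
    { ψ with
      commutes' := fun r => Eq.trans (Localization.localRingHom_to_map p q _ rfl r)
        (IsScalarTower.algebraMap_apply R A _ r).symm }
  let φ : A' →ₐ[R] Localization.AtPrime q :=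
    Algebra.TensorProduct.productMap ψ' (IsScalarTower.toAlgHom R A (Localization.AtPrime q))
  have hφA : ∀ c : A, φ (algebraMap A A' c) = algebraMap A (Localization.AtPrime q) c := by
    intro c
    have h0 : φ ((1 : R') ⊗ₜ[R] c) = ψ' 1 * algebraMap A (Localization.AtPrime q) c :=
      Algebra.TensorProduct.productMap_apply_tmul _ _ _ _
    rw [map_one, one_mul] at h0
    exact h0
  let φ' : A' →ₗ[A] Localization.AtPrime q :=
    { φ.toRingHom with
      map_smul' := fun c b => by
        change φ (c • b) = c • φ b
        rw [Algebra.smul_def, map_mul, hφA, Algebra.smul_def] }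
  have hφa : φ a ∈ IsLocalRing.maximalIdeal (Localization.AtPrime q) := by
    have : (IsLocalRing.maximalIdeal R').map (algebraMap R' A') ≤
        (IsLocalRing.maximalIdeal (Localization.AtPrime q)).comap φ.toRingHom := by
      rw [Ideal.map_le_iff_le_comap]
      intro r hr
      have h1 : φ (algebraMap R' A' r) = ψ r := by
        have h0 : φ (r ⊗ₜ[R] (1 : A)) =
            ψ r * IsScalarTower.toAlgHom R A (Localization.AtPrime q) 1 :=
          Algebra.TensorProduct.productMap_apply_tmul _ _ _ _
        rw [map_one, mul_one] at h0
        exact h0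
      rw [Ideal.mem_comap, Ideal.mem_comap]
      change φ (algebraMap R' A' r) ∈ IsLocalRing.maximalIdeal (Localization.AtPrime q)
      rw [h1]
      have := Localization.isLocalHom_localRingHom p q (algebraMap R A) rfl
      exact (IsLocalRing.maximalIdeal_comap ψ).ge hr
    exact this ha
  have h2 := congrArg (φ'.rTensor M) hax
  rw [TensorProduct.smul_tmul', smul_eq_mul, mul_one, LinearMap.rTensor_tmul,
    LinearMap.rTensor_tmul] at h2
  have h3 : φ' 1 = 1 := map_one φ
  have h4 : (1 - φ a) • ((1 : Localization.AtPrime q) ⊗ₜ[A] x) = 0 := by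
    rw [TensorProduct.smul_tmul', smul_eq_mul, mul_one, TensorProduct.sub_tmul, sub_eq_zero]
    rw [h3] at h2
    exact h2.symm
  have h5 : IsUnit (1 - φ a) := by
    by_contra hn
    have := add_mem ((IsLocalRing.mem_maximalIdeal _).2 hn) hφa
    rw [sub_add_cancel] at this
    exact (IsLocalRing.mem_maximalIdeal _).1 this isUnit_one
  exact (h5.smul_eq_zero).1 h4

attribute [local instance] Algebra.TensorProduct.rightAlgebra in
theorem stepF {R : Type*} [CommRing R] {A : Type*} [CommRing A] [Algebra R A]
    (hA : Algebra.FinitePresentation R A)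
    {M N : Type*} [AddCommGroup M] [Module R M] [Module A M] [IsScalarTower R A M]
    [AddCommGroup N] [Module R N] [Module A N] [IsScalarTower R A N]
    [Module.FinitePresentation A M] [Module.FinitePresentation A N]
    (u : M →ₗ[A] N) [Module.Flat R N]
    (h : ∀ (p : Ideal R) (_ : p.IsPrime), Function.Injective (LinearMap.rTensor
          (IsLocalRing.ResidueField (Localization.AtPrime p)) (u.restrictScalars R)))
    (R' : Type*) [CommRing R'] [Algebra R R'] :
    Function.Injective ((u.restrictScalars R).rTensor R') := by
  have hflat : Module.Flat R' ((R' ⊗[R] A) ⊗[A] N) := flat_bc (R := R) R' (R' ⊗[R] A) N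
  rw [fiber_bc (R' := R') (A' := R' ⊗[R] A)]
  have := stepG (R := R') (A := R' ⊗[R] A) (M := (R' ⊗[R] A) ⊗[A] M) (N := (R' ⊗[R] A) ⊗[A] N)
    inferInstance (u.baseChange (R' ⊗[R] A)) (by
    intro p hp
    rw [← fiber_bc (R := R) u]
    exact field_of_res _ h _)
  exact Module.Flat.rTensor_preserves_injective_linearMap (M := R')
    ((u.baseChange (R' ⊗[R] A)).restrictScalars R') this

theorem coker_flat {R : Type*} [CommRing R] 
    {M N : Type*} [AddCommGroup M] [Module R M]
    [AddCommGroup N] [Module R N] 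
    (u : M →ₗ[R] N) [Module.Flat R N]
    (h : ∀ I : Ideal R, Function.Injective (u.rTensor (R ⧸ I))) :
    Module.Flat R (N ⧸ LinearMap.range u) := by
  rw [Module.Flat.iff_lTensor_injective]
  intro I _
  rw [← LinearMap.ker_eq_bot, LinearMap.ker_eq_bot']
  intro z hz
  set π := (LinearMap.range u).mkQ with hπ
  have hex : Function.Exact u π := LinearMap.exact_map_mkQ_range u
  have hs : Function.Surjective π := Submodule.mkQ_surjective _
  obtain ⟨z, rfl⟩ := LinearMap.rTensor_surjective I hs z
  -- push to `N`
  have h1 : π.rTensor R (I.subtype.lTensor N z) = 0 := by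
    rw [← LinearMap.comp_apply, LinearMap.rTensor_comp_lTensor, ← LinearMap.lTensor_comp_rTensor]
    exact hz
  obtain ⟨y, hy⟩ := (rTensor_exact R hex hs _).1 h1
  have hIe : Function.Exact I.subtype I.mkQ := LinearMap.exact_subtype_mkQ I
  have h2 : I.mkQ.lTensor M y = 0 := by
    apply h I
    rw [map_zero, ← LinearMap.comp_apply, LinearMap.rTensor_comp_lTensor,
      ← LinearMap.lTensor_comp_rTensor, LinearMap.comp_apply, hy]
    exact (lTensor_exact N hIe I.mkQ_surjective _).2 ⟨z, rfl⟩
  obtain ⟨w, hw⟩ := (lTensor_exact M hIe I.mkQ_surjective _).1 h2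
  have h3 : u.rTensor I w = z := by
    apply Module.Flat.lTensor_preserves_injective_linearMap (M := N) I.subtype I.subtype_injective
    rw [← hy, ← hw, ← LinearMap.comp_apply, LinearMap.lTensor_comp_rTensor,
      ← LinearMap.rTensor_comp_lTensor]
    rfl
  exact (rTensor_exact I hex hs _).2 ⟨w, h3⟩

theorem inj_of_coker_flat {R : Type*} [CommRing R] 
    {M N : Type*} [AddCommGroup M] [Module R M]
    [AddCommGroup N] [Module R N] 
    (u : M →ₗ[R] N) (hu : Function.Injective u) [Module.Flat R (N ⧸ LinearMap.range u)]
    (V : Type*) [AddCommGroup V] [Module R V] : Function.Injective (u.rTensor V) := by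
  have := LinearMap.lTensor_injective_of_exact_of_flat (LinearMap.range u).mkQ
    (Submodule.mkQ_surjective _) u hu (LinearMap.exact_map_mkQ_range u) V
  exact (LinearMap.lTensor_inj_iff_rTensor_inj V u).1 this

end L9
end FibInj

/-- The affine form of Proposition 1.1 of the paper: for a finitely presented algebra `A`
over `R` and an `A`-linear map `u : M → N` of finitely presented `A`-modules with `N` flat
over `R`, `u` is injective on all fibers (tensored with the residue fields `κ(p)` of `R`)
iff `u` is injective with `R`-flat cokernel; in that case `u` stays injective after any
base change `R → R'`. -/
theorem stmt_14 (R A : Type*) [CommRing R] [CommRing A] [Algebra R A]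
    (hA : Algebra.FinitePresentation R A)
    (M N : Type*) [AddCommGroup M] [Module R M] [Module A M] [IsScalarTower R A M]
    [AddCommGroup N] [Module R N] [Module A N] [IsScalarTower R A N]
    [Module.FinitePresentation A M] [Module.FinitePresentation A N]
    [Module.Flat R N] (u : M →ₗ[A] N) :
    ((∀ (p : Ideal R) (_ : p.IsPrime),
        Function.Injective (LinearMap.rTensor
          (IsLocalRing.ResidueField (Localization.AtPrime p)) (u.restrictScalars R)))
      ↔ (Function.Injective u ∧ Module.Flat R (N ⧸ LinearMap.range u)))
    ∧ ((Function.Injective u ∧ Module.Flat R (N ⧸ LinearMap.range u)) →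
        ∀ (R' : Type*) [CommRing R'] [Algebra R R'],
          Function.Injective (LinearMap.rTensor R' (u.restrictScalars R))) := by
  have hr : LinearMap.range (u.restrictScalars R) = (LinearMap.range u).restrictScalars R := rfl
  let e : (N ⧸ LinearMap.range (u.restrictScalars R)) ≃ₗ[R] (N ⧸ LinearMap.range u) :=
    Submodule.Quotient.restrictScalarsEquiv R (LinearMap.range u)
  have hmore : ∀ (_ : Function.Injective u ∧ Module.Flat R (N ⧸ LinearMap.range u)),
      Module.Flat R (N ⧸ LinearMap.range (u.restrictScalars R)) := by
    rintro ⟨_, h2⟩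
    exact Module.Flat.of_linearEquiv e
  refine ⟨⟨fun h => ⟨FibInj.stepG hA u h, ?_⟩, fun h p hp => ?_⟩, fun h R' _ _ => ?_⟩
  · have := FibInj.coker_flat (u.restrictScalars R) (fun I => FibInj.stepF hA u h (R ⧸ I))
    exact Module.Flat.of_linearEquiv e.symm
  · have := hmore h
    exact FibInj.inj_of_coker_flat (u.restrictScalars R) h.1 _
  · have := hmore h
    exact FibInj.inj_of_coker_flat (u.restrictScalars R) h.1 _
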